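/- Consider the map g(R, θ) = (q_d, q_o) with q_d = (1 + R^2 tan^2 θ)/(R^2 + tan^2 θ), q_o = tan θ (R^2 − 1)/(R^2 + tan^2 θ), defined for R > 0 and θ ∈ (−π/4, π/4). Its Jacobian determinant ∂(q_d, q_o)/∂(θ, R) equals 2R(R^2 − 1)/(R^2 cos^2 θ + sin^2 θ)^3. -/

import Mathlib

open Real

noncomputable def qd (R θ : ℝ) : ℝ := (1 + R^2 * tan θ ^ 2) / (R^2 + tan θ ^ 2)

noncomputable def qo (R θ : ℝ) : ℝ := tan θ * (R^2 - 1) / (R^2 + tan θ ^ 2)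

theorem hasDerivAt_qd_angle {R θ : ℝ} (hR : 0 < R) (hc : cos θ ≠ 0) :
    HasDerivAt (fun θ' => qd R θ')
      (2 * tan θ * (R ^ 4 - 1) / (R ^ 2 + tan θ ^ 2) ^ 2 * (1 / cos θ ^ 2)) θ := by
  have hD : R ^ 2 + tan θ ^ 2 ≠ 0 := by positivity
  have ht := (hasDerivAt_tan hc).pow 2
  refine (((ht.const_mul (R ^ 2)).const_add 1).div (ht.const_add (R ^ 2)) hD).congr_deriv ?_
  simp only [Pi.pow_apply]
  field_simp
  push_cast
  ring

theorem hasDerivAt_qd_radius {R θ : ℝ} (hR : 0 < R) :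
    HasDerivAt (fun R' => qd R' θ)
      (2 * R * (tan θ ^ 4 - 1) / (R ^ 2 + tan θ ^ 2) ^ 2) R := by
  have hD : R ^ 2 + tan θ ^ 2 ≠ 0 := by positivity
  have hr := hasDerivAt_pow 2 R
  refine (((hr.mul_const (tan θ ^ 2)).const_add 1).div (hr.add_const (tan θ ^ 2)) hD).congr_deriv ?_
  field_simp
  push_cast
  ring

theorem hasDerivAt_qo_angle {R θ : ℝ} (hR : 0 < R) (hc : cos θ ≠ 0) :
    HasDerivAt (fun θ' => qo R θ')
      ((R ^ 2 - 1) * (R ^ 2 - tan θ ^ 2) / (R ^ 2 + tan θ ^ 2) ^ 2 * (1 / cos θ ^ 2)) θ := by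
  have hD : R ^ 2 + tan θ ^ 2 ≠ 0 := by positivity
  have ht := hasDerivAt_tan hc
  refine ((ht.mul_const (R ^ 2 - 1)).div ((ht.pow 2).const_add (R ^ 2)) hD).congr_deriv ?_
  simp only [Pi.pow_apply]
  field_simp
  push_cast
  ring

theorem hasDerivAt_qo_radius {R θ : ℝ} (hR : 0 < R) :
    HasDerivAt (fun R' => qo R' θ)
      (2 * R * tan θ * (tan θ ^ 2 + 1) / (R ^ 2 + tan θ ^ 2) ^ 2) R := by
  have hD : R ^ 2 + tan θ ^ 2 ≠ 0 := by positivity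
  have hr := hasDerivAt_pow 2 R
  refine (((hr.sub_const 1).const_mul (tan θ)).div (hr.add_const (tan θ ^ 2)) hD).congr_deriv ?_
  field_simp
  push_cast
  ring

theorem jacobian_det_qd_qo (R θ : ℝ) (hR : 0 < R) (hθ : θ ∈ Set.Ioo (-(π/4)) (π/4)) :
    Matrix.det !![deriv (fun θ' => qd R θ') θ, deriv (fun R' => qd R' θ) R;
                  deriv (fun θ' => qo R θ') θ, deriv (fun R' => qo R' θ) R] =
      2 * R * (R^2 - 1) / (R^2 * cos θ ^ 2 + sin θ ^ 2) ^ 3 := by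
  have hc : 0 < cos θ :=
    cos_pos_of_mem_Ioo ⟨by linarith [hθ.1, pi_pos], by linarith [hθ.2, pi_pos]⟩
  have hD : R ^ 2 + tan θ ^ 2 ≠ 0 := by positivity
  have hden : R ^ 2 * cos θ ^ 2 + sin θ ^ 2 = cos θ ^ 2 * (R ^ 2 + tan θ ^ 2) := by
    rw [tan_eq_sin_div_cos]
    field_simp
  have hsec : 1 / cos θ ^ 2 = 1 + tan θ ^ 2 := by
    rw [one_div, ← inv_one_add_tan_sq hc.ne', inv_inv]
  rw [Matrix.det_fin_two_of, (hasDerivAt_qd_angle hR hc.ne').deriv,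
    (hasDerivAt_qd_radius hR).deriv, (hasDerivAt_qo_angle hR hc.ne').deriv,
    (hasDerivAt_qo_radius hR).deriv, hden, mul_pow, ← div_div,
    div_eq_mul_one_div _ ((cos θ ^ 2) ^ 3), ← one_div_pow (cos θ ^ 2) 3, hsec]
  field_simp
  ring
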